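/- Let f ∈ 𝔪² define an isolated hypersurface singularity (i.e. μ(f) < ∞). Then dim_ℂ O/((f) + 𝔪·J(f)) = τ(f) + n, where 𝔪·J(f) denotes the product ideal (x₁,…,xₙ)·(∂f/∂x₁,…,∂f/∂xₙ). -/

import Mathlib

/-- Formal partial derivative of a multivariate power series with respect to variable `i`. -/
noncomputable def pd {n : ℕ} {R : Type*} [CommSemiring R] (i : Fin n)
    (f : MvPowerSeries (Fin n) R) : MvPowerSeries (Fin n) R :=
  fun m => (m i + 1) • f (m + Finsupp.single i 1)

/-- The maximal ideal `(x₁, …, xₙ)` of `ℂ[[x₁,…,xₙ]]`. -/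
noncomputable def mIdeal (n : ℕ) : Ideal (MvPowerSeries (Fin n) ℂ) :=
  Ideal.span (Set.range (MvPowerSeries.X : Fin n → MvPowerSeries (Fin n) ℂ))

/-- The Jacobian ideal `J(f) = (∂f/∂x₁, …, ∂f/∂xₙ)` of `f ∈ ℂ[[x₁,…,xₙ]]`. -/
noncomputable def jacIdeal {n : ℕ} (f : MvPowerSeries (Fin n) ℂ) :
    Ideal (MvPowerSeries (Fin n) ℂ) :=
  Ideal.span (Set.range fun i : Fin n => pd i f)

/-- A derivation preserving a proper ideal of finite colength in a local algebra over a field of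
characteristic zero maps the maximal ideal into itself. -/
theorem Derivation.mem_maximalIdeal_of_finite_quotient {k R : Type*} [Field k] [CharZero k]
    [CommRing R] [IsLocalRing R] [Algebra k R] (D : Derivation k R R) {K : Ideal R}
    (hK : K ≠ ⊤) [Module.Finite k (R ⧸ K)] (hD : ∀ a ∈ K, D a ∈ K) {x : R}
    (hx : x ∈ IsLocalRing.maximalIdeal R) : D x ∈ IsLocalRing.maximalIdeal R := by
  by_contra hDx
  have hu : IsUnit (D x) := by simpa using hDx
  have : IsArtinianRing (R ⧸ K) := IsArtinianRing.of_finite k (R ⧸ K)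
  obtain ⟨N, y, hy⟩ :=
    IsArtinian.exists_pow_succ_smul_dvd (Ideal.Quotient.mk K x) (1 : R ⧸ K)
  obtain ⟨y, rfl⟩ := Ideal.Quotient.mk_surjective y
  have hxN : x ^ N * (1 - x * y) ∈ K := by
    rw [← Ideal.Quotient.eq_zero_iff_mem]
    simp only [map_mul, map_pow, map_sub, map_one, smul_eq_mul, Nat.succ_eq_add_one] at hy ⊢
    linear_combination -hy
  have hunit : IsUnit (1 - x * y) := by
    by_contra h
    have h1 := (IsLocalRing.maximalIdeal R).add_mem ((IsLocalRing.mem_maximalIdeal _).2 h)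
      (Ideal.mul_mem_right y _ hx)
    rw [sub_add_cancel] at h1
    exact (IsLocalRing.mem_maximalIdeal _).1 h1 isUnit_one
  rw [Ideal.mul_unit_mem_iff_mem K hunit] at hxN
  have key : ∀ m : ℕ, x ^ m ∉ K := by
    intro m
    induction m with
    | zero => simpa using (Ideal.ne_top_iff_one K).1 hK
    | succ m ih =>
      intro h
      have h2 := hD _ h
      rw [D.leibniz_pow, Nat.add_sub_cancel, smul_eq_mul, nsmul_eq_mul, ← mul_assoc,
        Ideal.mul_unit_mem_iff_mem K hu] at h2
      have hm : IsUnit ((m + 1 : ℕ) : R) := by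
        have : IsUnit ((m + 1 : ℕ) : k) := (Nat.cast_ne_zero.2 m.succ_ne_zero).isUnit
        simpa using this.map (algebraMap k R)
      exact ih ((Ideal.unit_mul_mem_iff_mem K hm).1 h2)
  exact key N hxN

theorem pd_eq_pderiv {n : ℕ} {R : Type*} [CommSemiring R] (i : Fin n)
    (f : MvPowerSeries (Fin n) R) : pd i f = MvPowerSeries.pderiv R i f := by
  ext m
  rw [MvPowerSeries.coeff_pderiv, MvPowerSeries.coeff_apply]
  simp [pd, MvPowerSeries.coeff_apply, mul_comm]

theorem MvPowerSeries.pderiv_comm {σ R : Type*} [CommSemiring R] (i j : σ)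
    (f : MvPowerSeries σ R) :
    pderiv R i (pderiv R j f) = pderiv R j (pderiv R i f) := by
  classical
  ext m
  simp only [coeff_pderiv, add_right_comm m (Finsupp.single i 1)]
  by_cases h : i = j
  · subst h; rfl
  · simp [h, Ne.symm h]
    ring

theorem mem_mIdeal_iff {n : ℕ} {h : MvPowerSeries (Fin n) ℂ} :
    h ∈ mIdeal n ↔ MvPowerSeries.constantCoeff h = 0 := by
  classical
  constructor
  · intro hh
    have : mIdeal n ≤ RingHom.ker (MvPowerSeries.constantCoeff (σ := Fin n) (R := ℂ)) := by
      rw [mIdeal, Ideal.span_le]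
      rintro _ ⟨i, rfl⟩
      simp
    exact this hh
  · intro hh
    let c : Fin n → MvPowerSeries (Fin n) ℂ := fun i m =>
      if ∀ j < i, m j = 0 then MvPowerSeries.coeff (m + Finsupp.single i 1) h else 0
    have hc : h = ∑ i, c i * MvPowerSeries.X i := by
      ext m
      have hterm : ∀ i, MvPowerSeries.coeff m (c i * MvPowerSeries.X i) =
          if m i ≠ 0 ∧ ∀ j < i, m j = 0 then MvPowerSeries.coeff m h else 0 := by
        intro i
        rw [MvPowerSeries.X, MvPowerSeries.coeff_mul_monomial, mul_one]
        by_cases hi : m i = 0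
        · simp [hi, Finsupp.single_le_iff]
        · have hle : Finsupp.single i 1 ≤ m := by
            rw [Finsupp.single_le_iff]; omega
          have hP : (∀ j < i, (m - Finsupp.single i 1 : Fin n →₀ ℕ) j = 0) ↔ ∀ j < i, m j = 0 := by
            refine forall₂_congr fun j hj => ?_
            simp [hj.ne']
          rw [if_pos hle, MvPowerSeries.coeff_apply]
          simp only [c, hP, tsub_add_cancel_of_le hle, hi, ne_eq, not_false_eq_true, true_and]
      rw [map_sum]
      simp_rw [hterm]
      by_cases hm : m = 0
      · subst hm
        simpa using hh
      · have hex : ∃ i, m i ≠ 0 := by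
          by_contra! hall
          exact hm (Finsupp.ext hall)
        have hS : (Finset.univ.filter fun i => m i ≠ 0).Nonempty := by
          obtain ⟨i, hi⟩ := hex
          exact ⟨i, by simpa using hi⟩
        have hmem := Finset.min'_mem _ hS
        have hmin := fun j hj => Finset.min'_le (Finset.univ.filter fun i => m i ≠ 0) j hj
        set i₀ := (Finset.univ.filter fun i => m i ≠ 0).min' hS
        simp only [Finset.mem_filter, Finset.mem_univ, true_and] at hmem hmin
        have hlt : ∀ j < i₀, m j = 0 := by
          intro j hj
          by_contra h0
          exact absurd (hmin j h0) (not_le.2 hj)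
        rw [Finset.sum_eq_single i₀]
        · rw [if_pos ⟨hmem, hlt⟩]
        · intro b _ hb
          rw [if_neg]
          rintro ⟨hb0, hb1⟩
          exact hmem (hb1 i₀ (lt_of_le_of_ne (hmin b hb0) hb.symm))
        · simp
    rw [hc]
    exact Ideal.sum_mem _ fun i _ =>
      Ideal.mul_mem_left _ _ (Ideal.subset_span ⟨i, rfl⟩)

theorem mIdeal_eq_maximalIdeal (n : ℕ) :
    mIdeal n = IsLocalRing.maximalIdeal (MvPowerSeries (Fin n) ℂ) := by
  ext h
  rw [mem_mIdeal_iff, IsLocalRing.mem_maximalIdeal, mem_nonunits_iff,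
    MvPowerSeries.isUnit_iff_constantCoeff, isUnit_iff_ne_zero, not_not]

theorem Derivation.mem_of_mem_sq {R A : Type*} [CommSemiring R] [CommRing A] [Algebra R A]
    (D : Derivation R A A) {I : Ideal A} {a : A} (ha : a ∈ I ^ 2) : D a ∈ I := by
  rw [sq] at ha
  induction ha using Submodule.mul_induction_on' with
  | mem_mul_mem x hx y hy =>
    rw [D.leibniz]
    exact I.add_mem (I.mul_mem_right _ hx) (I.mul_mem_right _ hy)
  | add x _ y _ hx hy => rw [map_add]; exact I.add_mem hx hy

theorem jacIdeal_le_mIdeal {n : ℕ} {f : MvPowerSeries (Fin n) ℂ} (hf : f ∈ mIdeal n ^ 2) :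
    jacIdeal f ≤ mIdeal n := by
  rw [jacIdeal, Ideal.span_le]
  rintro _ ⟨i, rfl⟩
  simp only [pd_eq_pderiv]
  exact (MvPowerSeries.pderiv ℂ i).mem_of_mem_sq hf

theorem mem_jacIdeal_iff {n : ℕ} {f h : MvPowerSeries (Fin n) ℂ} :
    h ∈ jacIdeal f ↔ ∃ a : Fin n → MvPowerSeries (Fin n) ℂ, ∑ i, a i * pd i f = h :=
  Ideal.mem_span_range_iff_exists_fun

theorem mem_mIdeal_mul_jacIdeal_iff {n : ℕ} {f h : MvPowerSeries (Fin n) ℂ} :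
    h ∈ mIdeal n * jacIdeal f ↔
      ∃ a : Fin n → MvPowerSeries (Fin n) ℂ, (∀ i, a i ∈ mIdeal n) ∧ ∑ i, a i * pd i f = h := by
  constructor
  · intro hh
    induction hh using Submodule.mul_induction_on' with
    | mem_mul_mem x hx y hy =>
      obtain ⟨a, rfl⟩ := mem_jacIdeal_iff.1 hy
      refine ⟨fun i => x * a i, fun i => Ideal.mul_mem_right _ _ hx, ?_⟩
      simp [Finset.mul_sum, mul_assoc]
    | add x _ y _ hx hy =>
      obtain ⟨a, ha, rfl⟩ := hx
      obtain ⟨b, hb, rfl⟩ := hy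
      exact ⟨fun i => a i + b i, fun i => Ideal.add_mem _ (ha i) (hb i), by
        simp [add_mul, Finset.sum_add_distrib]⟩
  · rintro ⟨a, ha, rfl⟩
    exact Ideal.sum_mem _ fun i _ =>
      Ideal.mul_mem_mul (ha i) (Ideal.subset_span ⟨i, rfl⟩)

/-- A vector field that is tangent to an isolated hypersurface singularity vanishes at the origin. -/
theorem coeff_mem_mIdeal_of_sum_mul_pd_mem {n : ℕ} {f : MvPowerSeries (Fin n) ℂ}
    (hf : f ∈ mIdeal n ^ 2)
    [Module.Finite ℂ (MvPowerSeries (Fin n) ℂ ⧸ (Ideal.span {f} + jacIdeal f))]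
    {a : Fin n → MvPowerSeries (Fin n) ℂ} (ha : ∑ i, a i * pd i f ∈ Ideal.span {f})
    (i : Fin n) : a i ∈ mIdeal n := by
  classical
  let D : Derivation ℂ (MvPowerSeries (Fin n) ℂ) (MvPowerSeries (Fin n) ℂ) :=
    ∑ j, a j • MvPowerSeries.pderiv ℂ j
  have hDapp : ∀ h, D h = ∑ j, a j * MvPowerSeries.pderiv ℂ j h := by
    intro h
    simp only [D, ← Derivation.coeFnAddMonoidHom_apply, map_sum, Finset.sum_apply]
    simp
  set K : Ideal (MvPowerSeries (Fin n) ℂ) := Ideal.span {f} + jacIdeal f with hKdef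
  have hfK : f ∈ K := Ideal.mem_sup_left (Ideal.mem_span_singleton_self f)
  have hpK : ∀ j, MvPowerSeries.pderiv ℂ j f ∈ K := fun j =>
    Ideal.mem_sup_right (Ideal.subset_span ⟨j, pd_eq_pderiv j f⟩)
  have hK : K ≠ ⊤ := by
    have hle : K ≤ mIdeal n := sup_le
      ((Ideal.span_singleton_le_iff_mem _).2 (Ideal.pow_le_self two_ne_zero hf))
      (jacIdeal_le_mIdeal hf)
    rw [mIdeal_eq_maximalIdeal] at hle
    exact fun h => Ideal.IsPrime.ne_top' (top_le_iff.1 (h ▸ hle))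
  have hKspan : K = Ideal.span ({f} ∪ Set.range fun j => MvPowerSeries.pderiv ℂ j f) := by
    simp only [hKdef, jacIdeal, pd_eq_pderiv, Ideal.span_union, Submodule.add_eq_sup]
  simp only [pd_eq_pderiv, ← hDapp] at ha
  obtain ⟨g, hg⟩ := Ideal.mem_span_singleton'.1 ha
  have hDK : ∀ h ∈ K, D h ∈ K := by
    intro h hh
    rw [hKspan] at hh
    induction hh using Submodule.span_induction with
    | mem x hx =>
      rcases hx with rfl | ⟨j, rfl⟩
      · exact Ideal.mem_sup_left ha
      · have hcomm : D (MvPowerSeries.pderiv ℂ j f) = MvPowerSeries.pderiv ℂ j (D f) -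
            ∑ l, MvPowerSeries.pderiv ℂ j (a l) * MvPowerSeries.pderiv ℂ l f := by
          rw [hDapp, hDapp, map_sum, ← Finset.sum_sub_distrib]
          refine Finset.sum_congr rfl fun l _ => ?_
          rw [Derivation.leibniz, MvPowerSeries.pderiv_comm l j, smul_eq_mul, smul_eq_mul]
          ring
        change D (MvPowerSeries.pderiv ℂ j f) ∈ K
        rw [hcomm, ← hg, Derivation.leibniz]
        exact K.sub_mem (K.add_mem (K.mul_mem_left _ (hpK j)) (K.mul_mem_right _ hfK))
          (K.sum_mem fun l _ => K.mul_mem_left _ (hpK l))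
    | zero => simp
    | add x y _ _ hx hy => rw [map_add]; exact K.add_mem hx hy
    | smul b x hx hDx =>
      rw [smul_eq_mul, Derivation.leibniz]
      have hxK : x ∈ K := hKspan ▸ hx
      exact K.add_mem (K.mul_mem_left _ hDx) (K.mul_mem_right _ hxK)
  have hX : (MvPowerSeries.X i : MvPowerSeries (Fin n) ℂ) ∈ IsLocalRing.maximalIdeal _ := by
    rw [← mIdeal_eq_maximalIdeal]
    exact Ideal.subset_span ⟨i, rfl⟩
  have hDX : D (MvPowerSeries.X i) = a i := by
    simp [hDapp, MvPowerSeries.pderiv_X, Pi.single_apply]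
  rw [mIdeal_eq_maximalIdeal, ← hDX]
  exact D.mem_maximalIdeal_of_finite_quotient hK hDK hX

/-- for `f ∈ 𝔪²` defining an isolated hypersurface singularity
(`μ(f) = dim_ℂ O/J(f) < ∞`), one has `dim_ℂ O/((f) + 𝔪·J(f)) = τ(f) + n`, where
`τ(f) = dim_ℂ O/((f) + J(f))` is the Tjurina number. -/
theorem dim_quot_f_mJf (n : ℕ) (hn : 1 ≤ n) (f : MvPowerSeries (Fin n) ℂ)
    (hf2 : f ∈ (mIdeal n) ^ 2)
    (hmu : Module.Finite ℂ (MvPowerSeries (Fin n) ℂ ⧸ jacIdeal f)) :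
    Module.Finite ℂ
      (MvPowerSeries (Fin n) ℂ ⧸ (Ideal.span {f} + mIdeal n * jacIdeal f)) ∧
    Module.finrank ℂ
      (MvPowerSeries (Fin n) ℂ ⧸ (Ideal.span {f} + mIdeal n * jacIdeal f)) =
    Module.finrank ℂ
      (MvPowerSeries (Fin n) ℂ ⧸ (Ideal.span {f} + jacIdeal f)) + n := by
  set N := Ideal.span {f} + mIdeal n * jacIdeal f with hN
  set K := Ideal.span {f} + jacIdeal f with hK
  have hNK : N ≤ K := sup_le_sup_left Ideal.mul_le_right _
  have hJK : jacIdeal f ≤ K := le_sup_right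
  have hfinK : Module.Finite ℂ (MvPowerSeries (Fin n) ℂ ⧸ K) :=
    Module.Finite.of_surjective (Ideal.Quotient.factorₐ ℂ hJK).toLinearMap
      (Ideal.Quotient.factor_surjective hJK)
  let π : (MvPowerSeries (Fin n) ℂ ⧸ N) →ₗ[ℂ] (MvPowerSeries (Fin n) ℂ ⧸ K) :=
    (Ideal.Quotient.factorₐ ℂ hNK).toLinearMap
  have hπ : Function.Surjective π := Ideal.Quotient.factor_surjective hNK
  let L : (Fin n → ℂ) →ₗ[ℂ] (MvPowerSeries (Fin n) ℂ ⧸ N) :=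
    Fintype.linearCombination ℂ fun i => Ideal.Quotient.mk N (pd i f)
  have hL : ∀ c, L c = Ideal.Quotient.mk N (∑ i, MvPowerSeries.C (c i) * pd i f) := by
    intro c
    simp only [L, Fintype.linearCombination_apply, map_sum]
    refine Finset.sum_congr rfl fun i _ => ?_
    rw [← MvPowerSeries.smul_eq_C_mul]
    rfl
  have hLinj : Function.Injective L := by
    rw [← LinearMap.ker_eq_bot, LinearMap.ker_eq_bot']
    intro c hc
    rw [hL, Ideal.Quotient.eq_zero_iff_mem] at hc
    obtain ⟨u, hu, v, hv, huv⟩ := Submodule.mem_sup.1 hc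
    obtain ⟨a, ha, rfl⟩ := mem_mIdeal_mul_jacIdeal_iff.1 hv
    have hmem : ∑ i, (MvPowerSeries.C (c i) - a i) * pd i f ∈ Ideal.span {f} := by
      simp only [sub_mul, Finset.sum_sub_distrib]
      rwa [← huv, add_sub_cancel_right]
    ext i
    have h1 := Ideal.add_mem _ (coeff_mem_mIdeal_of_sum_mul_pd_mem hf2 hmem i) (ha i)
    rw [sub_add_cancel, mem_mIdeal_iff] at h1
    simpa using h1
  have hrange : LinearMap.range L = LinearMap.ker π := by
    apply le_antisymm
    · rintro _ ⟨c, rfl⟩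
      rw [LinearMap.mem_ker, hL]
      refine Ideal.Quotient.eq_zero_iff_mem.2 (hJK ?_)
      exact mem_jacIdeal_iff.2 ⟨_, rfl⟩
    · intro x hx
      obtain ⟨h, rfl⟩ := Ideal.Quotient.mk_surjective x
      have hh : h ∈ K := Ideal.Quotient.eq_zero_iff_mem.1 hx
      obtain ⟨u, hu, v, hv, rfl⟩ := Submodule.mem_sup.1 hh
      obtain ⟨a, rfl⟩ := mem_jacIdeal_iff.1 hv
      refine ⟨fun i => MvPowerSeries.constantCoeff (a i), ?_⟩
      rw [hL, eq_comm, Ideal.Quotient.eq, add_sub_assoc, ← Finset.sum_sub_distrib]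
      refine Submodule.add_mem_sup hu (mem_mIdeal_mul_jacIdeal_iff.2
        ⟨fun i => a i - MvPowerSeries.C (MvPowerSeries.constantCoeff (a i)), fun i => ?_, ?_⟩)
      · simp [mem_mIdeal_iff]
      · simp only [sub_mul]
  have hker : Module.Finite ℂ (LinearMap.ker π) := hrange ▸ inferInstance
  have hquot : Module.Finite ℂ ((MvPowerSeries (Fin n) ℂ ⧸ N) ⧸ LinearMap.ker π) :=
    Module.Finite.equiv (π.quotKerEquivOfSurjective hπ).symm
  have hfinN : Module.Finite ℂ (MvPowerSeries (Fin n) ℂ ⧸ N) :=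
    Module.Finite.of_submodule_quotient (LinearMap.ker π)
  refine ⟨hfinN, ?_⟩
  have hdim := π.finrank_range_add_finrank_ker
  rw [LinearMap.range_eq_top.2 hπ, finrank_top, ← hrange, LinearMap.finrank_range_of_inj hLinj,
    Module.finrank_fin_fun] at hdim
  exact hdim.symm
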